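/- Given a Cantor set A ⊂ ℂ and a connected open neighborhood V of A, let 𝒢 be a collection of holomorphic IFS (G, Ω_G) such that: (1) A_G = A and V ⊂ Ω_G for every G ∈ 𝒢; and (2) either (a) there exists r > 0 such that for every G ∈ 𝒢 and any two different g, g̃ ∈ G one has dist(g(A), g̃(A)) ≥ r (in particular the strong separation condition holds), or (b) A ⊂ ℝ, A ⊂ V ∩ ℝ, 𝒢 consists of real IFS that satisfy the strong separation condition, and sup{ #G : G ∈ 𝒢 } < ∞. Then the collection of restrictions { g|_V : g ∈ G for some G ∈ 𝒢 } is finite. -/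

import Mathlib

open Set Metric

noncomputable section

/-- A finite holomorphic IFS: a bounded domain `Ω ⊂ ℂ` together with finitely many
univalent maps `g i : Ω → Ω` with `closure (g i '' Ω) ⊆ Ω`. -/
structure HolIFS where
  /-- the number of maps -/
  m : ℕ
  hm : 1 ≤ m
  /-- the domain -/
  Ω : Set ℂ
  hopen : IsOpen Ω
  hconn : IsConnected Ω
  hbdd : Bornology.IsBounded Ω
  /-- the maps of the IFS -/
  g : Fin m → ℂ → ℂ
  hdiff : ∀ i, DifferentiableOn ℂ (g i) Ω
  hinj : ∀ i, Set.InjOn (g i) Ω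
  hcl : ∀ i, closure (g i '' Ω) ⊆ Ω

/-- `A` is the attractor of the IFS `S`: the (unique) nonempty compact subset of `Ω`
with `A = ⋃ i, g i '' A`. -/
def HolIFS.IsAttractor (S : HolIFS) (A : Set ℂ) : Prop :=
  A.Nonempty ∧ IsCompact A ∧ A ⊆ S.Ω ∧ A = ⋃ i, S.g i '' A

/-- The strong separation condition for the IFS `S` with attractor `A`. -/
def HolIFS.SSC (S : HolIFS) (A : Set ℂ) : Prop :=
  ∀ i j : Fin S.m, i ≠ j → Disjoint (S.g i '' A) (S.g j '' A)

/-- For a finite word `w = [i₁, …, i_k]`, the composition `g_w = g i₁ ∘ ⋯ ∘ g i_k`. -/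
def HolIFS.word (S : HolIFS) (w : List (Fin S.m)) : ℂ → ℂ :=
  w.foldr (fun i f => S.g i ∘ f) id

/-- A holomorphic IFS is real if its domain is symmetric w.r.t. `ℝ` and all its maps
commute with complex conjugation on the domain. -/
def HolIFS.IsReal (S : HolIFS) : Prop :=
  (∀ z ∈ S.Ω, (starRingEnd ℂ) z ∈ S.Ω) ∧
  ∀ i : Fin S.m, ∀ z ∈ S.Ω, S.g i ((starRingEnd ℂ) z) = (starRingEnd ℂ) (S.g i z)



lemma aux_bloch {F : ℂ → ℂ} {c : ℂ} {R : ℝ} (hR : 0 < R)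
    (hF : DifferentiableOn ℂ F (ball c R)) :
    ∃ q, ball q (R * ‖deriv F c‖ / 192) ⊆ F '' ball c R := by
  by_cases h0 : deriv F c = 0
  · exact ⟨0, by simp [h0]⟩
  have hF' : DifferentiableOn ℂ (deriv F) (ball c R) := hF.deriv isOpen_ball
  have hsub : closedBall c (R/2) ⊆ ball c R := closedBall_subset_ball (by linarith)
  obtain ⟨a, ha, hmax⟩ := (isCompact_closedBall c (R/2)).exists_isMaxOn
    ⟨c, mem_closedBall_self (by linarith)⟩
    (f := fun z => ‖deriv F z‖ * (R/2 - dist z c))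
    (((hF'.continuousOn.mono hsub).norm).mul (by fun_prop))
  have hmax' : ∀ z ∈ closedBall c (R/2), ‖deriv F z‖ * (R/2 - dist z c) ≤
    ‖deriv F a‖ * (R/2 - dist a c) := fun z hz => hmax hz
  have h1 := hmax' c (mem_closedBall_self (by linarith))
  rw [dist_self, sub_zero] at h1
  have hc0 : 0 < ‖deriv F c‖ := norm_pos_iff.2 h0
  have hpos : 0 < ‖deriv F a‖ * (R/2 - dist a c) := lt_of_lt_of_le (by positivity) h1
  have hac : dist a c ≤ R/2 := ha
  have hD : 0 < ‖deriv F a‖ := by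
    by_contra h
    have : ‖deriv F a‖ = 0 := le_antisymm (not_lt.1 h) (norm_nonneg _)
    simp [this] at hpos
  have hs0 : 0 < R/2 - dist a c := by
    by_contra h
    nlinarith
  set D := ‖deriv F a‖ with hDdef
  obtain ⟨s, hs⟩ : ∃ s, s = (R/2 - dist a c)/2 := ⟨_, rfl⟩
  have hsp : 0 < s := by rw [hs]; linarith
  have hballs : ball a s ⊆ ball c R := by
    apply ball_subset_ball'; rw [hs]; linarith [dist_nonneg (x := a) (y := c)]
  have hb2 : ∀ z ∈ ball a s, ‖deriv F z‖ ≤ 2 * D := by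
    intro z hz
    have hz' : dist z a < s := hz
    have htri := dist_triangle z a c
    have h2 := hmax' z (by rw [mem_closedBall]; linarith)
    have : ‖deriv F z‖ * s ≤ 2 * D * s := by
      calc ‖deriv F z‖ * s ≤ ‖deriv F z‖ * (R/2 - dist z c) := by gcongr; linarith
        _ ≤ _ := h2
        _ = 2 * D * s := by rw [hs]; ring
    exact le_of_mul_le_mul_right this hsp
  have hschw : ∀ z ∈ ball a s, dist (deriv F z) (deriv F a) ≤ 3 * D / s * dist z a := by
    intro z hz
    refine Complex.dist_le_div_mul_dist_of_mapsTo_ball (hF'.mono hballs) ?_ hz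
    intro y hy
    rw [mem_closedBall, dist_eq_norm]
    calc _ ≤ ‖deriv F y‖ + ‖deriv F a‖ := norm_sub_le _ _
      _ ≤ 2 * D + D := by gcongr; exact hb2 y hy
      _ = 3 * D := by ring
  have hb6 : ball a (s/6) ⊆ ball a s := ball_subset_ball (by linarith)
  have hdiffat : ∀ z ∈ ball c R, DifferentiableAt ℂ F z := fun z hz =>
    hF.differentiableAt (isOpen_ball.mem_nhds hz)
  have hlip : ∀ z ∈ ball a (s/6), D / 2 * ‖z - a‖ ≤ ‖F z - F a‖ := by
    intro z hz
    have hmv := (convex_ball a (s/6)).norm_image_sub_le_of_norm_hasDerivWithin_le (𝕜 := ℂ)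
      (f := fun z => F z - deriv F a * z)
      (f' := fun z => deriv F z - deriv F a) (C := D/2) (x := a) (y := z)
      (fun x hx => by
        have h1 := (hdiffat x (hballs (hb6 hx))).hasDerivAt
        have h2 := (hasDerivAt_id x).const_mul (deriv F a)
        simpa using (h1.fun_sub h2).hasDerivWithinAt)
      (fun x hx => by
        have := hschw x (hb6 hx)
        rw [dist_eq_norm] at this
        refine this.trans ?_
        have hx' : dist x a < s/6 := hx
        calc 3 * D / s * dist x a ≤ 3 * D / s * (s/6) := by gcongr
          _ = D/2 := by field_simp; norm_num)
      (mem_ball_self (by linarith)) hz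
    have e : deriv F a * (z - a) = (F z - F a) - (F z - deriv F a * z - (F a - deriv F a * a)) := by
      ring
    have : D * ‖z - a‖ ≤ ‖F z - F a‖ + D/2 * ‖z - a‖ := by
      rw [hDdef, ← norm_mul, e]
      exact (norm_sub_le _ _).trans (by gcongr)
    linarith
  have hcb : closedBall a (s/12) ⊆ ball a (s/6) := closedBall_subset_ball (by linarith)
  refine ⟨F a, ?_⟩
  have hcov := DiffContOnCl.ball_subset_image_closedBall (f := F) (z₀ := a) (r := s/12)
    (ε := D * s / 24) ?_ (by linarith) ?_ ?_
  · refine Subset.trans ?_ (hcov.trans (image_mono (hcb.trans (hb6.trans hballs))))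
    apply ball_subset_ball
    have : D * (R/2 - dist a c) = 2 * (D * s) := by rw [hs]; ring
    linarith
  · apply DifferentiableOn.diffContOnCl
    apply hF.mono
    exact closure_ball_subset_closedBall.trans (hcb.trans (hb6.trans hballs))
  · intro z hz
    have hz' : ‖z - a‖ = s/12 := by simpa [dist_eq_norm] using hz
    have := hlip z (hcb (sphere_subset_closedBall hz))
    rw [hz'] at this
    linarith
  · have : ∀ᶠ z in nhdsWithin a {a}ᶜ, F z ≠ F a := by
      filter_upwards [self_mem_nhdsWithin, nhdsWithin_le_nhds (ball_mem_nhds a (show 0 < s/6 by linarith))]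
        with z hz hz2 heq
      have := hlip z hz2
      rw [heq, sub_self, norm_zero] at this
      have : 0 < ‖z - a‖ := norm_pos_iff.2 (sub_ne_zero.2 hz)
      nlinarith
    exact this.frequently.filter_mono nhdsWithin_le_nhds

/-- a branch of logarithm with injective exponential has controlled derivative -/
lemma aux_logbound {l : ℂ → ℂ} {c : ℂ} {R : ℝ} (hR : 0 < R)
    (hl : DifferentiableOn ℂ l (ball c R)) (hinj : InjOn (fun z => Complex.exp (l z)) (ball c R)) :
    R * ‖deriv l c‖ ≤ 768 := by
  by_contra hcon
  push Not at hcon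
  obtain ⟨q, hq⟩ := aux_bloch hR hl
  have h4 : ball q 4 ⊆ l '' ball c R := (ball_subset_ball (by linarith)).trans hq
  have hp := Real.pi_pos
  have hp4 := Real.pi_lt_four
  have e1 : ‖(Real.pi : ℂ) * Complex.I‖ < 4 := by
    simp [abs_of_pos hp, hp4]
  obtain ⟨x, hx, hxe⟩ := h4 (show q + Real.pi * Complex.I ∈ ball q 4 by
    simpa [mem_ball, dist_eq_norm] using e1)
  obtain ⟨y, hy, hye⟩ := h4 (show q - Real.pi * Complex.I ∈ ball q 4 by
    simpa [mem_ball, dist_eq_norm] using e1)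
  have hxy : x = y := by
    apply hinj hx hy
    simp only [hxe, hye]
    rw [show q + Real.pi * Complex.I = (q - Real.pi * Complex.I) + 2 * Real.pi * Complex.I by ring,
      Complex.exp_periodic]
  rw [hxy, hye] at hxe
  have : (Real.pi : ℂ) * Complex.I = 0 := by linear_combination (-1/2) * hxe
  simp at this

lemma aux_log {f : ℂ → ℂ} {c : ℂ} {R : ℝ} (hR : 0 < R)
    (hf : DifferentiableOn ℂ f (ball c R)) (h0 : ∀ z ∈ ball c R, f z ≠ 0) :
    ∃ l : ℂ → ℂ, DifferentiableOn ℂ l (ball c R) ∧ (∀ z ∈ ball c R, Complex.exp (l z) = f z) ∧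
      ∀ z ∈ ball c R, deriv l z = deriv f z / f z := by
  have hd : DifferentiableOn ℂ (fun z => deriv f z / f z) (ball c R) :=
    (hf.deriv isOpen_ball).div hf h0
  obtain ⟨l, hlc, hl⟩ := hd.isExactOn_ball.with_val_at c (Complex.log (f c))
  have hlo : DifferentiableOn ℂ l (ball c R) := fun z hz =>
    (hl z hz).differentiableAt.differentiableWithinAt
  refine ⟨l, hlo, ?_, fun z hz => (hl z hz).deriv⟩
  intro z hz
  have hder : ∀ x ∈ ball c R, HasDerivAt (fun z => f z * Complex.exp (- l z)) 0 x := by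
    intro x hx
    have h1 := (hf.differentiableAt (isOpen_ball.mem_nhds hx)).hasDerivAt
    have h2 := (hl x hx).fun_neg.cexp
    have h3 := h1.fun_mul h2
    have := h0 x hx
    have e : deriv f x * Complex.exp (-l x) + f x * (Complex.exp (-l x) * -(deriv f x / f x)) = 0 := by
      field_simp
      ring
    rwa [e] at h3
  have hconst := (convex_ball c R).norm_image_sub_le_of_norm_hasDerivWithin_le (𝕜 := ℂ)
    (C := 0) (fun x hx => (hder x hx).hasDerivWithinAt) (by simp) (mem_ball_self hR) hz
  have hc := h0 c (mem_ball_self hR)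
  simp only [zero_mul, norm_le_zero_iff, sub_eq_zero] at hconst
  rw [hlc, Complex.exp_neg, Complex.exp_neg, Complex.exp_log hc, mul_inv_cancel₀ hc] at hconst
  have := Complex.exp_ne_zero (l z)
  field_simp at hconst
  exact hconst.symm

/-- weak Koebe quarter theorem -/
lemma aux_quarter {f : ℂ → ℂ} {c w : ℂ} {R : ℝ} (hR : 0 < R)
    (hf : DifferentiableOn ℂ f (ball c R)) (hinj : InjOn f (ball c R))
    (hw : ∀ z ∈ ball c R, f z ≠ w) : R * ‖deriv f c‖ ≤ 768 * ‖f c - w‖ := by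
  obtain ⟨l, hl, hle, hld⟩ := aux_log (f := fun z => f z - w) hR (hf.sub_const w)
    (fun z hz => sub_ne_zero.2 (hw z hz))
  have := aux_logbound hR hl (by
    intro x hx y hy hxy
    simp only [hle x hx, hle y hy] at hxy
    exact hinj hx hy (by linear_combination hxy))
  have hc := mem_ball_self (x := c) hR
  rw [hld c hc, norm_div, deriv_sub_const] at this
  have h0 : 0 < ‖f c - w‖ := norm_pos_iff.2 (sub_ne_zero.2 (hw c hc))
  rwa [← mul_div_assoc, div_le_iff₀ h0] at this

lemma aux_growth {f : ℂ → ℂ} {c w z : ℂ} {R : ℝ} (hR : 0 < R)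
    (hf : DifferentiableOn ℂ f (ball c R)) (hinj : InjOn f (ball c R))
    (hw : ∀ z ∈ ball c R, f z ≠ w) (hz : z ∈ ball c (R/2)) :
    ‖f z - w‖ ≤ Real.exp 768 * ‖f c - w‖ := by
  obtain ⟨l, hl, hle, hld⟩ := aux_log (f := fun z => f z - w) hR (hf.sub_const w)
    (fun z hz => sub_ne_zero.2 (hw z hz))
  have hb : ∀ x ∈ ball c (R/2), ‖deriv l x‖ ≤ 768 / (R/2) := by
    intro x hx
    have hsub : ball x (R/2) ⊆ ball c R := by
      apply ball_subset_ball'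
      have : dist x c < R/2 := hx
      linarith
    have := aux_logbound (c := x) (R := R/2) (by linarith) (hl.mono hsub) (by
      intro x hx y hy hxy
      simp only [hle x (hsub hx), hle y (hsub hy)] at hxy
      exact hinj (hsub hx) (hsub hy) (by linear_combination hxy))
    rw [le_div_iff₀ (by linarith)]; linarith
  have hsub2 : ball c (R/2) ⊆ ball c R := ball_subset_ball (by linarith)
  have hmv := (convex_ball c (R/2)).norm_image_sub_le_of_norm_deriv_le
    (fun x hx => hl.differentiableAt (isOpen_ball.mem_nhds (hsub2 hx))) hb
    (mem_ball_self (by linarith)) hz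
  have hz' : ‖z - c‖ < R/2 := by simpa [dist_eq_norm] using hz
  have h768 : ‖l z - l c‖ ≤ 768 := hmv.trans (by
    calc 768 / (R/2) * ‖z - c‖ ≤ 768 / (R/2) * (R/2) := by gcongr
      _ = 768 := by field_simp)
  have e : f z - w = Complex.exp (l z - l c) * (f c - w) := by
    rw [← hle z (hsub2 hz), ← hle c (mem_ball_self hR), ← Complex.exp_add]; congr 1; ring
  rw [e, norm_mul, Complex.norm_exp]
  gcongr
  exact (Complex.re_le_norm _).trans h768

lemma aux_minmod {f : ℂ → ℂ} {p : ℂ} {R : ℝ} (hR : 0 < R)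
    (hf : DifferentiableOn ℂ f (ball p R)) (hinj : InjOn f (ball p R)) (hd : deriv f p ≠ 0) :
    ∃ q ∈ sphere p (R/2), ‖f q - f p‖ ≤ R/2 * ‖deriv f p‖ := by
  have hp := mem_ball_self (x := p) hR
  have hds : DifferentiableOn ℂ (dslope f p) (ball p R) :=
    (Complex.differentiableOn_dslope (isOpen_ball.mem_nhds hp)).2 hf
  have hne : ∀ z ∈ ball p R, dslope f p z ≠ 0 := by
    intro z hz
    by_cases h : z = p
    · rw [h, dslope_same]; exact hd
    · rw [dslope_of_ne _ h, slope_def_field]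
      refine div_ne_zero (sub_ne_zero.2 fun e => h (hinj hz hp e)) (sub_ne_zero.2 h)
  have hsub : closure (ball p (R/2)) ⊆ ball p R :=
    closure_ball_subset_closedBall.trans (closedBall_subset_ball (by linarith))
  obtain ⟨q, hq, hmax⟩ := Complex.exists_mem_frontier_isMaxOn_norm (F := ℂ)
    (f := fun z => (dslope f p z)⁻¹) (U := ball p (R/2)) isBounded_ball
    ⟨p, mem_ball_self (by linarith)⟩
    ((hds.inv hne).mono hsub).diffContOnCl
  rw [frontier_ball _ (by linarith)] at hq
  refine ⟨q, hq, ?_⟩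
  have hqn : ‖q - p‖ = R/2 := by simpa [dist_eq_norm] using hq
  have hqp : q ≠ p := by
    rintro rfl
    simp at hqn; linarith
  have h1 : ‖(dslope f p p)⁻¹‖ ≤ ‖(dslope f p q)⁻¹‖ :=
    hmax (subset_closure (mem_ball_self (by linarith)))
  have hqb : q ∈ ball p R := by
    rw [mem_ball, dist_eq_norm, hqn]; linarith
  rw [dslope_same, norm_inv, norm_inv] at h1
  have h2 := (inv_le_inv₀ (norm_pos_iff.2 hd) (norm_pos_iff.2 (hne q hqb))).1 h1
  rw [dslope_of_ne _ hqp, slope_def_field, norm_div, hqn, div_le_iff₀ (by linarith)] at h2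
  linarith

lemma aux_local0 {f : ℂ → ℂ} {p z : ℂ} {R : ℝ} (hR : 0 < R)
    (hf : DifferentiableOn ℂ f (ball p R)) (hinj : InjOn f (ball p R)) (hd : deriv f p ≠ 0)
    (hz : z ∈ ball p (R/4)) :
    ‖f z - f p‖ ≤ (Real.exp 768 + 1) * (R/2) * ‖deriv f p‖ ∧
    ‖deriv f z‖ ≤ 1536 * Real.exp 768 * ‖deriv f p‖ := by
  obtain ⟨q, hq, hqle⟩ := aux_minmod hR hf hinj hd
  have hqn : dist q p = R/2 := hq
  have hqb : q ∈ ball p R := by rw [mem_ball, hqn]; linarith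
  have hsub : ball p (R/2) ⊆ ball p R := ball_subset_ball (by linarith)
  have hom : ∀ y ∈ ball p (R/2), f y ≠ f q := by
    intro y hy e
    have := hinj (hsub hy) hqb e
    rw [this, mem_ball, hqn] at hy
    linarith
  have hE := Real.exp_pos 768
  have hg := aux_growth (R := R/2) (by linarith) (hf.mono hsub) (hinj.mono hsub) hom
    (z := z) (by convert hz using 2; ring)
  rw [norm_sub_rev (f p)] at hg
  have hg2 : ‖f z - f q‖ ≤ Real.exp 768 * (R/2 * ‖deriv f p‖) := hg.trans (by gcongr)
  have hzd : dist z p < R/4 := hz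
  have hsub2 : ball z (R/4) ⊆ ball p (R/2) := ball_subset_ball' (by linarith)
  have hqt := aux_quarter (c := z) (w := f q) (R := R/4) (by linarith)
    (hf.mono (hsub2.trans hsub)) (hinj.mono (hsub2.trans hsub)) (fun y hy => hom y (hsub2 hy))
  constructor
  · calc ‖f z - f p‖ ≤ ‖f z - f q‖ + ‖f q - f p‖ := norm_sub_le_norm_sub_add_norm_sub _ _ _
      _ ≤ Real.exp 768 * (R/2 * ‖deriv f p‖) + R/2 * ‖deriv f p‖ := by gcongr
      _ = _ := by ring
  · have : R/4 * ‖deriv f z‖ ≤ R/4 * (1536 * Real.exp 768 * ‖deriv f p‖) := by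
      calc _ ≤ _ := hqt
        _ ≤ 768 * (Real.exp 768 * (R/2 * ‖deriv f p‖)) := by gcongr
        _ = _ := by ring
    exact le_of_mul_le_mul_left this (by linarith)

lemma aux_deriv_ne {f : ℂ → ℂ} {p : ℂ} {R : ℝ} (hR : 0 < R)
    (hf : DifferentiableOn ℂ f (ball p R)) (hinj : InjOn f (ball p R)) : deriv f p ≠ 0 := by
  intro h0
  have hp := mem_ball_self (x := p) hR
  have hfr : ∀ ε > 0, ε ≤ R → ∃ z ∈ ball p ε, deriv f z ≠ 0 := by
    intro ε hε hεR
    by_contra hcon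
    push Not at hcon
    have hsub : ball p ε ⊆ ball p R := ball_subset_ball hεR
    have hq : p + (ε/2 : ℝ) ∈ ball p ε := by
      simp [mem_ball, dist_eq_norm, abs_of_pos hε]; linarith
    have := (convex_ball p ε).norm_image_sub_le_of_norm_deriv_le (C := 0)
      (fun x hx => hf.differentiableAt (isOpen_ball.mem_nhds (hsub hx)))
      (fun x hx => by simp [hcon x hx]) (mem_ball_self hε) hq
    simp only [zero_mul, norm_le_zero_iff, sub_eq_zero] at this
    have := hinj (hsub hq) hp this
    simp at this
    linarith
  obtain ⟨z0, hz0, hz0d⟩ := hfr (R/16) (by linarith) (by linarith)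
  have hE := Real.exp_pos 768
  have hcont : ContinuousAt (deriv f) p :=
    ((hf.deriv isOpen_ball).differentiableAt (isOpen_ball.mem_nhds hp)).continuousAt
  have hpos : 0 < ‖deriv f z0‖ / (1536 * Real.exp 768) := by
    have := norm_pos_iff.2 hz0d
    positivity
  obtain ⟨δ, hδ, hδ2⟩ := Metric.continuousAt_iff.1 hcont _ hpos
  obtain ⟨y, hy, hyd⟩ := hfr (min δ (R/16)) (lt_min hδ (by linarith))
    ((min_le_right _ _).trans (by linarith))
  have hy1 : dist y p < δ := lt_of_lt_of_le hy (min_le_left _ _)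
  have hy2 : dist y p < R/16 := lt_of_lt_of_le hy (min_le_right _ _)
  have hz1 : dist z0 p < R/16 := hz0
  have hsub : ball y (R/2) ⊆ ball p R := ball_subset_ball' (by linarith)
  have := (aux_local0 (p := y) (z := z0) (R := R/2) (by linarith) (hf.mono hsub) (hinj.mono hsub)
    hyd (by rw [mem_ball]; linarith [dist_triangle_right z0 y p])).2
  have h3 := hδ2 hy1
  rw [h0, dist_zero_right, lt_div_iff₀ (by positivity)] at h3
  linarith

/-- the comparison relation used for chaining -/
def AuxT (V : Set ℂ) (C : ℝ) (p z : ℂ) : Prop :=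
  ∀ f : ℂ → ℂ, DifferentiableOn ℂ f V → InjOn f V →
    ‖f z - f p‖ ≤ C * ‖deriv f p‖ ∧ ‖deriv f z‖ ≤ C * ‖deriv f p‖

lemma AuxT.mono {V : Set ℂ} {C C' : ℝ} {p z : ℂ} (h : AuxT V C p z) (hC : C ≤ C') :
    AuxT V C' p z := fun f hf hi =>
  ⟨(h f hf hi).1.trans (by gcongr), (h f hf hi).2.trans (by gcongr)⟩

lemma AuxT.trans {V : Set ℂ} {C C' : ℝ} {p y z : ℂ} (h : AuxT V C p y) (h' : AuxT V C' y z)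
    (hC : 0 ≤ C) (hC' : 0 ≤ C') :
    AuxT V (C' * C + C) p z := fun f hf hi => by
  obtain ⟨h1, h2⟩ := h f hf hi
  obtain ⟨h3, h4⟩ := h' f hf hi
  have h5 : C' * ‖deriv f y‖ ≤ C' * (C * ‖deriv f p‖) := by gcongr
  have h6 : 0 ≤ C * ‖deriv f p‖ := by positivity
  constructor
  · calc ‖f z - f p‖ ≤ ‖f z - f y‖ + ‖f y - f p‖ := norm_sub_le_norm_sub_add_norm_sub _ _ _
      _ ≤ C' * (C * ‖deriv f p‖) + C * ‖deriv f p‖ := by linarith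
      _ = _ := by ring
  · linarith

lemma aux_T_local {V : Set ℂ} {x : ℂ} (hV : IsOpen V) (hx : x ∈ V) :
    ∃ C, 0 ≤ C ∧ ∃ r > 0, ∀ p ∈ ball x r, ∀ z ∈ ball x r, AuxT V C p z := by
  obtain ⟨ε, hε, hεV⟩ := Metric.isOpen_iff.1 hV x hx
  have hE := Real.exp_pos 768
  refine ⟨max ((Real.exp 768 + 1) * (ε/2/2)) (1536 * Real.exp 768), by positivity, ε/16,
    by positivity, ?_⟩
  intro p hp z hz f hf hi
  rw [mem_ball] at hp hz
  have hsub : ball p (ε/2) ⊆ V := (ball_subset_ball' (by linarith)).trans hεV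
  have h := aux_local0 (p := p) (z := z) (R := ε/2) (by linarith) (hf.mono hsub) (hi.mono hsub)
    (aux_deriv_ne (R := ε/2) (by linarith) (hf.mono hsub) (hi.mono hsub))
    (by rw [mem_ball]; linarith [dist_triangle_right z p x])
  exact ⟨h.1.trans (by gcongr; exact le_max_left _ _), h.2.trans (by gcongr; exact le_max_right _ _)⟩

lemma aux_T_pair {V : Set ℂ} (hV : IsOpen V) (hc : IsPreconnected V) {x y : ℂ} (hx : x ∈ V)
    (hy : y ∈ V) :
    ∃ C, 0 ≤ C ∧ ∃ r > 0, ∀ p ∈ ball x r, ∀ z ∈ ball y r, AuxT V C p z := by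
  refine hc.induction₂' (fun x y => ∃ C, 0 ≤ C ∧ ∃ r > 0, ∀ p ∈ ball x r, ∀ z ∈ ball y r,
    AuxT V C p z) ?_ ?_ hx hy
  · intro x hx
    obtain ⟨C, hC, r, hr, h⟩ := aux_T_local hV hx
    filter_upwards [nhdsWithin_le_nhds (ball_mem_nhds x (half_pos hr))] with y hy
    have hy' : dist y x < r/2 := hy
    have s1 : ball y (r/2) ⊆ ball x r := ball_subset_ball' (by linarith)
    have s2 : ball x (r/2) ⊆ ball x r := ball_subset_ball (by linarith)
    exact ⟨⟨C, hC, r/2, half_pos hr, fun p hp z hz => h p (s2 hp) z (s1 hz)⟩,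
      ⟨C, hC, r/2, half_pos hr, fun p hp z hz => h p (s1 hp) z (s2 hz)⟩⟩
  · rintro x y z - - - ⟨C, hC, r, hr, h⟩ ⟨C', hC', r', hr', h'⟩
    refine ⟨C' * C + C, by positivity, min r r', lt_min hr hr', fun p hp q hq => ?_⟩
    exact (h p (ball_subset_ball (min_le_left _ _) hp) y (mem_ball_self hr)).trans
      (h' y (mem_ball_self hr') q (ball_subset_ball (min_le_right _ _) hq)) hC hC'

lemma aux_T_compact {V N : Set ℂ} (hV : IsOpen V) (hc : IsPreconnected V) (hN : IsCompact N)
    (hNV : N ⊆ V) : ∃ C, 0 ≤ C ∧ ∀ p ∈ N, ∀ z ∈ N, AuxT V C p z := by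
  have := (hN.prod hN).induction_on (p := fun S => ∃ C, 0 ≤ C ∧ ∀ q ∈ S, AuxT V C q.1 q.2)
    ⟨0, le_rfl, by simp⟩
    (fun s t hst ⟨C, hC, h⟩ => ⟨C, hC, fun q hq => h q (hst hq)⟩)
    (fun s t ⟨C, hC, h⟩ ⟨C', hC', h'⟩ => ⟨max C C', le_max_of_le_left hC, fun q hq =>
      hq.elim (fun hq => (h q hq).mono (le_max_left _ _)) (fun hq => (h' q hq).mono (le_max_right _ _))⟩)
    (fun q hq => by
      obtain ⟨C, hC, r, hr, h⟩ := aux_T_pair hV hc (hNV hq.1) (hNV hq.2)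
      refine ⟨ball q.1 r ×ˢ ball q.2 r, mem_nhdsWithin_of_mem_nhds
        (prod_mem_nhds (ball_mem_nhds _ hr) (ball_mem_nhds _ hr)), C, hC, fun w hw => h _ hw.1 _ hw.2⟩)
  obtain ⟨C, hC, h⟩ := this
  exact ⟨C, hC, fun p hp z hz => h (p, z) ⟨hp, hz⟩⟩

/-- distortion theorem on compact subsets -/
lemma aux_distortion {V N : Set ℂ} (hV : IsOpen V) (hc : IsPreconnected V) (hN : IsCompact N)
    (hNV : N ⊆ V) : ∃ C, 0 < C ∧ ∀ f : ℂ → ℂ, DifferentiableOn ℂ f V → InjOn f V →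
      ∀ a ∈ N, ∀ b ∈ N, ∀ c ∈ N,
        ‖f a - f b‖ ≤ C * ‖deriv f c‖ ∧
        ∀ d ∈ N, ‖f a - f b‖ * ‖c - d‖ ≤ C * ‖f c - f d‖ := by
  obtain ⟨C, hC, h⟩ := aux_T_compact hV hc hN hNV
  obtain ⟨δ, hδ, hδV⟩ := hN.exists_cthickening_subset_open hV hNV
  obtain ⟨D, hD⟩ := hN.isBounded.exists_norm_le
  have hD2 : ∀ c ∈ N, ∀ d ∈ N, ‖c - d‖ ≤ 2 * |D| := fun c hc d hd =>
    (norm_sub_le _ _).trans (by linarith [hD c hc, hD d hd, le_abs_self D])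
  refine ⟨2 * C + 1 + 2 * C * (768 * (2 * |D| + δ) / δ), by positivity, ?_⟩
  intro f hf hi a ha b hb c hc'
  have h1 : ‖f a - f b‖ ≤ 2 * C * ‖deriv f c‖ := by
    have e1 := (h c hc' a ha f hf hi).1
    have e2 := (h c hc' b hb f hf hi).1
    calc ‖f a - f b‖ = ‖(f a - f c) - (f b - f c)‖ := by congr 1; ring
      _ ≤ ‖f a - f c‖ + ‖f b - f c‖ := norm_sub_le _ _
      _ ≤ _ := by linarith
  constructor
  · refine h1.trans ?_
    gcongr
    have : 0 ≤ 2 * C * (768 * (2 * |D| + δ) / δ) := by positivity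
    linarith
  · intro d hd
    have key : ‖deriv f c‖ * ‖c - d‖ ≤ (768 * (2 * |D| + δ) / δ) * ‖f c - f d‖ := by
      by_cases hcd : c = d
      · simp [hcd]
      have hpos : 0 < ‖c - d‖ := norm_pos_iff.2 (sub_ne_zero.2 hcd)
      have hsub : ball c (min ‖c - d‖ δ) ⊆ V := by
        refine Subset.trans ?_ hδV
        refine (ball_subset_ball (min_le_right _ _)).trans (ball_subset_closedBall.trans ?_)
        exact closedBall_subset_cthickening hc' δ
      have hq := aux_quarter (c := c) (w := f d) (R := min ‖c - d‖ δ) (lt_min hpos hδ)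
        (hf.mono hsub) (hi.mono hsub) (by
          intro z hz e
          have := hi (hsub hz) (hNV hd) e
          rw [this, mem_ball, dist_eq_norm, norm_sub_rev] at hz
          exact absurd (lt_of_lt_of_le hz (min_le_left _ _)) (lt_irrefl _))
      have hmin : ‖c - d‖ * δ ≤ min ‖c - d‖ δ * (2 * |D| + δ) := by
        have h2 := hD2 c hc' d hd
        rcases le_total ‖c - d‖ δ with h | h
        · rw [min_eq_left h]; nlinarith [abs_nonneg D]
        · rw [min_eq_right h]; nlinarith
      rw [div_mul_eq_mul_div, le_div_iff₀ hδ]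
      have hDp : 0 ≤ 2 * |D| + δ := by positivity
      calc ‖deriv f c‖ * ‖c - d‖ * δ = ‖deriv f c‖ * (‖c - d‖ * δ) := by ring
        _ ≤ ‖deriv f c‖ * (min ‖c - d‖ δ * (2 * |D| + δ)) := by gcongr
        _ = (min ‖c - d‖ δ * ‖deriv f c‖) * (2 * |D| + δ) := by ring
        _ ≤ (768 * ‖f c - f d‖) * (2 * |D| + δ) := by gcongr
        _ = _ := by ring
    calc ‖f a - f b‖ * ‖c - d‖ ≤ (2 * C * ‖deriv f c‖) * ‖c - d‖ := by gcongr
      _ = 2 * C * (‖deriv f c‖ * ‖c - d‖) := by ring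
      _ ≤ 2 * C * ((768 * (2 * |D| + δ) / δ) * ‖f c - f d‖) := by gcongr
      _ = (2 * C * (768 * (2 * |D| + δ) / δ)) * ‖f c - f d‖ := by ring
      _ ≤ _ := by gcongr; linarith

lemma HolIFS.mapsTo_g (S : HolIFS) (i : Fin S.m) : MapsTo (S.g i) S.Ω S.Ω :=
  fun _ hx => S.hcl i (subset_closure (mem_image_of_mem _ hx))

lemma HolIFS.word_cons (S : HolIFS) (i : Fin S.m) (w : List (Fin S.m)) :
    S.word (i :: w) = S.g i ∘ S.word w := rfl

lemma HolIFS.word_snoc (S : HolIFS) (w : List (Fin S.m)) (i : Fin S.m) :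
    S.word (w ++ [i]) = S.word w ∘ S.g i := by
  induction w with
  | nil => rfl
  | cons j w ih => rw [List.cons_append, S.word_cons, ih, S.word_cons]; rfl

lemma HolIFS.word_props (S : HolIFS) (w : List (Fin S.m)) :
    MapsTo (S.word w) S.Ω S.Ω ∧ DifferentiableOn ℂ (S.word w) S.Ω ∧ InjOn (S.word w) S.Ω := by
  induction w with
  | nil => exact ⟨fun x hx => hx, differentiableOn_id, injOn_id _⟩
  | cons i w ih =>
    rw [S.word_cons]
    exact ⟨(S.mapsTo_g i).comp ih.1, (S.hdiff i).comp ih.2.1 ih.1, (S.hinj i).comp ih.2.2 ih.1⟩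

lemma HolIFS.exists_margin (S : HolIFS) : ∃ δ > 0, ∀ i, ∀ z ∈ S.Ω, ∀ u : ℂ, ‖u‖ ≤ δ →
    S.g i z + u ∈ S.Ω := by
  have h : ∀ i, ∃ δ > 0, cthickening δ (closure (S.g i '' S.Ω)) ⊆ S.Ω := fun i =>
    IsCompact.exists_cthickening_subset_open
      ((S.hbdd.subset (subset_closure.trans (S.hcl i))).isCompact_closure) S.hopen (S.hcl i)
  choose δ hδ h using h
  have : Nonempty (Fin S.m) := ⟨⟨0, S.hm⟩⟩
  obtain ⟨i0, hi0⟩ := Finite.exists_min δ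
  refine ⟨δ i0, hδ i0, fun i z hz u hu => h i ?_⟩
  refine closedBall_subset_cthickening (subset_closure (mem_image_of_mem _ hz)) _ ?_
  simpa [mem_closedBall, dist_eq_norm] using hu.trans (hi0 i)

lemma HolIFS.expand (S : HolIFS) : ∃ t > (0 : ℝ), ∀ x ∈ S.Ω, ∀ w : List (Fin S.m),
    ∃ K : ℂ → ℂ, DifferentiableOn ℂ K S.Ω ∧ MapsTo K S.Ω S.Ω ∧ K x = S.word w x ∧
      deriv K x = (1 + t : ℝ) ^ w.length * deriv (S.word w) x := by
  obtain ⟨δ, hδ, hm⟩ := S.exists_margin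
  obtain ⟨M, hM⟩ := S.hbdd.exists_norm_le
  refine ⟨δ / (2 * (|M| + 1)), by positivity, ?_⟩
  set t := δ / (2 * (|M| + 1)) with ht
  have htp : 0 < t := by positivity
  intro x hx w
  induction w with
  | nil => exact ⟨id, differentiableOn_id, fun x hx => hx, rfl, by simp [HolIFS.word]⟩
  | cons i w ih =>
    obtain ⟨K, hK, hKm, hKx, hKd⟩ := ih
    obtain ⟨hwm, hwd, -⟩ := S.word_props w
    set y := S.word w x with hy
    have hyΩ : y ∈ S.Ω := hwm hx
    let k : ℂ → ℂ := fun z => S.g i z + (t : ℂ) * (S.g i z - S.g i y)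
    have hkd : DifferentiableOn ℂ k S.Ω :=
      (S.hdiff i).add (((S.hdiff i).sub_const _).const_mul _)
    have hkm : MapsTo k S.Ω S.Ω := by
      intro z hz
      apply hm i z hz
      have h1 : ‖S.g i z - S.g i y‖ ≤ 2 * (|M| + 1) := by
        refine (norm_sub_le _ _).trans ?_
        linarith [hM _ (S.mapsTo_g i hz), hM _ (S.mapsTo_g i hyΩ), le_abs_self M]
      rw [norm_mul, Complex.norm_real, Real.norm_of_nonneg htp.le]
      calc t * ‖S.g i z - S.g i y‖ ≤ t * (2 * (|M| + 1)) := by gcongr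
        _ = δ := by rw [ht]; field_simp
    have hgy := ((S.hdiff i).differentiableAt (S.hopen.mem_nhds hyΩ)).hasDerivAt
    have hky : HasDerivAt k ((1 + t : ℝ) * deriv (S.g i) y) y := by
      have := hgy.fun_add ((hgy.sub_const (S.g i y)).const_mul (t : ℂ))
      have e : ((1 + t : ℝ) : ℂ) * deriv (S.g i) y = deriv (S.g i) y + t * deriv (S.g i) y := by
        push_cast; ring
      rw [e]; exact this
    refine ⟨k ∘ K, hkd.comp hK hKm, hkm.comp hKm, ?_, ?_⟩
    · simp [k, hKx, S.word_cons, hy]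
    · have hKx' := (hK.differentiableAt (S.hopen.mem_nhds hx)).hasDerivAt
      have hwx' := (hwd.differentiableAt (S.hopen.mem_nhds hx)).hasDerivAt
      rw [← hKx] at hky
      rw [(hky.comp x hKx').deriv, S.word_cons, (HasDerivAt.comp x (by rw [← hy]; exact hgy) hwx').deriv,
        hKd, hKx]
      simp only [List.length_cons]
      ring

lemma HolIFS.diam_small (S : HolIFS) {A : Set ℂ} (hA : S.IsAttractor A) {ε : ℝ} (hε : 0 < ε) :
    ∃ n, ∀ w : List (Fin S.m), w.length = n → ∀ a ∈ A, ∀ b ∈ A,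
      ‖S.word w a - S.word w b‖ < ε := by
  obtain ⟨⟨c, hc⟩, hAc, hAΩ, -⟩ := hA
  obtain ⟨C, hC, hdist⟩ := aux_distortion S.hopen S.hconn.isPreconnected hAc hAΩ
  obtain ⟨t, ht, hexp⟩ := S.expand
  obtain ⟨M, hM⟩ := S.hbdd.exists_norm_le
  obtain ⟨ρ, hρ, hρΩ⟩ := Metric.nhds_basis_closedBall.mem_iff.1 (S.hopen.mem_nhds (hAΩ hc))
  obtain ⟨n, hn⟩ := pow_unbounded_of_one_lt (C * (M / ρ) / ε) (show 1 < 1 + t by linarith)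
  refine ⟨n, fun w hw a ha b hb => ?_⟩
  obtain ⟨K, hK, hKm, -, hKd⟩ := hexp c (hAΩ hc) w
  have h1 : ‖deriv K c‖ ≤ M / ρ := by
    refine Complex.norm_deriv_le_of_forall_mem_sphere_norm_le hρ ?_ ?_
    · apply DifferentiableOn.diffContOnCl
      exact hK.mono (closure_ball_subset_closedBall.trans hρΩ)
    · intro z hz
      exact hM _ (hKm (hρΩ (sphere_subset_closedBall hz)))
  obtain ⟨-, hwd, hwi⟩ := S.word_props w
  have h2 := (hdist _ hwd hwi a ha b hb c hc).1
  have hpp : 0 < (1 + t) ^ n := by positivity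
  rw [hKd, norm_mul, norm_pow, Complex.norm_real, Real.norm_of_nonneg (by linarith), hw] at h1
  rw [div_lt_iff₀ hε] at hn
  have h3 : (1 + t) ^ n * ‖S.word w a - S.word w b‖ < (1 + t) ^ n * ε := by
    calc _ ≤ (1 + t) ^ n * (C * ‖deriv (S.word w) c‖) := by gcongr
      _ = C * ((1 + t) ^ n * ‖deriv (S.word w) c‖) := by ring
      _ ≤ C * (M / ρ) := by gcongr
      _ < _ := hn
  exact lt_of_mul_lt_mul_left h3 hpp.le

lemma HolIFS.exists_gap (S : HolIFS) {A : Set ℂ} (hA : S.IsAttractor A) (hs : S.SSC A) :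
    ∃ r > 0, ∀ i, ∀ y ∈ S.g i '' A, ∀ z ∈ A, z ∉ S.g i '' A → r ≤ ‖y - z‖ := by
  obtain ⟨-, hAc, hAΩ, hAe⟩ := hA
  have hcomp : ∀ i, IsCompact (S.g i '' A) := fun i =>
    hAc.image_of_continuousOn ((S.hdiff i).continuousOn.mono hAΩ)
  have h : ∀ i j, ∃ r > (0:ℝ), i ≠ j → ∀ y ∈ S.g i '' A, ∀ z ∈ S.g j '' A, r ≤ ‖y - z‖ := by
    intro i j
    by_cases hij : i = j
    · exact ⟨1, one_pos, fun h => absurd hij h⟩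
    obtain ⟨r, hr, h⟩ := Metric.exists_pos_forall_lt_edist (hcomp i) (hcomp j).isClosed (hs i j hij)
    refine ⟨r, hr, fun _ y hy z hz => ?_⟩
    have := h y hy z hz
    rw [edist_nndist, ENNReal.coe_lt_coe] at this
    rw [← dist_eq_norm]
    exact_mod_cast this.le
  choose r hr h using h
  have : Nonempty (Fin S.m) := ⟨⟨0, S.hm⟩⟩
  obtain ⟨p, hp⟩ := Finite.exists_min (fun p : Fin S.m × Fin S.m => r p.1 p.2)
  refine ⟨r p.1 p.2, hr _ _, fun i y hy z hz hzi => ?_⟩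
  rw [hAe] at hz
  obtain ⟨j, hj⟩ := mem_iUnion.1 hz
  refine (hp (i, j)).trans (h i j ?_ y hy z hj)
  rintro rfl
  exact hzi hj

lemma HolIFS.cylinders (S : HolIFS) {A : Set ℂ} (hA : S.IsAttractor A) (hs : S.SSC A)
    (hAiso : ∀ x ∈ A, x ∈ closure (A \ {x})) :
    ∃ C > 0, ∀ x ∈ A, ∀ ε > 0, ∃ K ⊆ A, IsCompact K ∧ x ∈ K ∧
      (∀ p ∈ K, ∀ q ∈ K, ‖p - q‖ ≤ C * ε) ∧ ∀ y ∈ K, ∀ z ∈ A, ‖y - z‖ ≤ ε → z ∈ K := by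
  obtain ⟨r, hr, hgap⟩ := S.exists_gap hA hs
  have hA' := hA
  obtain ⟨-, hAc, hAΩ, hAe⟩ := hA
  obtain ⟨C, hC, hdist⟩ := aux_distortion S.hopen S.hconn.isPreconnected hAc hAΩ
  have hgA : ∀ i, S.g i '' A ⊆ A := fun i => by
    conv_rhs => rw [hAe]
    exact subset_iUnion (fun i => S.g i '' A) i
  have hwA : ∀ w, S.word w '' A ⊆ A := by
    intro w
    induction w with
    | nil => rintro _ ⟨x, hx, rfl⟩; exact hx
    | cons i w ih =>
      rintro _ ⟨x, hx, rfl⟩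
      exact hgA i ⟨_, ih ⟨x, hx, rfl⟩, rfl⟩
  refine ⟨C / r, by positivity, fun x hx ε hε => ?_⟩
  let P : List (Fin S.m) → Prop := fun w =>
    ∀ y ∈ S.word w '' A, ∀ z ∈ A, ‖y - z‖ ≤ ε → z ∈ S.word w '' A
  have key : ∃ w, x ∈ S.word w '' A ∧ P w ∧ ∃ i, ¬ P (w ++ [i]) := by
    by_contra hcon
    push Not at hcon
    have hall : ∀ n, ∃ w : List (Fin S.m), w.length = n ∧ x ∈ S.word w '' A ∧ P w := by
      intro n
      induction n with
      | zero => exact ⟨[], rfl, ⟨x, hx, rfl⟩, fun y _ z hz _ => ⟨z, hz, rfl⟩⟩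
      | succ n ih =>
        obtain ⟨w, hwn, ⟨a, ha, hax⟩, hPw⟩ := ih
        have ha' := ha
        rw [hAe] at ha'
        obtain ⟨i, b, hb, hba⟩ := mem_iUnion.1 ha'
        refine ⟨w ++ [i], by simp [hwn], ⟨b, hb, ?_⟩, hcon w ⟨a, ha, hax⟩ hPw i⟩
        rw [S.word_snoc, Function.comp_apply, hba, hax]
    obtain ⟨z, ⟨hzA, hzx⟩, hzd⟩ := Metric.mem_closure_iff.1 (hAiso x hx) ε hε
    have hzx' : z ≠ x := hzx
    obtain ⟨n, hn⟩ := S.diam_small hA' (norm_pos_iff.2 (sub_ne_zero.2 hzx'))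
    obtain ⟨w, hwn, hxw, hPw⟩ := hall n
    obtain ⟨b, hb, hbz⟩ := hPw x hxw z hzA (by rw [← dist_eq_norm]; exact hzd.le)
    obtain ⟨a, ha, hax⟩ := hxw
    have := hn w hwn b hb a ha
    rw [hbz, hax] at this
    exact lt_irrefl _ this
  obtain ⟨w, hxw, hPw, i, hPi⟩ := key
  obtain ⟨-, hwd, hwi⟩ := S.word_props w
  refine ⟨S.word w '' A, hwA w, hAc.image_of_continuousOn (hwd.continuousOn.mono hAΩ), hxw, ?_, hPw⟩
  simp only [P] at hPi
  push Not at hPi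
  obtain ⟨y, ⟨a, ha, hay⟩, z, hz, hyz, hzn⟩ := hPi
  rw [S.word_snoc] at hay hzn
  obtain ⟨b, hb, hbz⟩ := hPw y ⟨S.g i a, hgA i ⟨a, ha, rfl⟩, hay⟩ z hz hyz
  have hbn : b ∉ S.g i '' A := by
    rintro ⟨b', hb', rfl⟩
    exact hzn ⟨b', hb', hbz⟩
  have hr' := hgap i (S.g i a) ⟨a, ha, rfl⟩ b hb hbn
  rintro _ ⟨p, hp, rfl⟩ _ ⟨q, hq, rfl⟩
  have h1 := (hdist _ hwd hwi p hp q hq (S.g i a) (hgA i ⟨a, ha, rfl⟩)).2 b hb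
  rw [hbz, show S.word w (S.g i a) = y from hay] at h1
  rw [div_mul_eq_mul_div, le_div_iff₀ hr]
  calc _ ≤ ‖S.word w p - S.word w q‖ * ‖S.g i a - b‖ := by gcongr
    _ ≤ _ := h1
    _ ≤ _ := by gcongr

lemma aux_rigid {A : Set ℂ} {C : ℝ} (hC : 0 < C)
    (hcyl : ∀ x ∈ A, ∀ ε > 0, ∃ K ⊆ A, IsCompact K ∧ x ∈ K ∧
      (∀ p ∈ K, ∀ q ∈ K, ‖p - q‖ ≤ C * ε) ∧ ∀ y ∈ K, ∀ z ∈ A, ‖y - z‖ ≤ ε → z ∈ K)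
    {f g : ℂ → ℂ} {κ η ρ : ℝ} {x0 : ℂ} (hκ : 0 < κ) (hη : 0 < η)
    (hfA : MapsTo f A A) (hgA : MapsTo g A A)
    (hlow : ∀ a ∈ A, ∀ b ∈ A, κ * ‖a - b‖ ≤ ‖f a - f b‖)
    (hlip : ∀ a ∈ A, ∀ b ∈ A, ‖(g a - f a) - (g b - f b)‖ ≤ η * ‖a - b‖)
    (hsup : ∀ a ∈ A, ‖g a - f a‖ ≤ η)
    (hint : ∀ z ∈ A, ‖z - x0‖ < ρ → z ∈ f '' A)
    (h1 : 4 * C * η ≤ κ) (h2 : 4 * C * η ≤ ρ) :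
    ∀ a ∈ A, ‖f a - x0‖ < ρ / 2 → g a = f a := by
  intro a ha hax
  by_contra hne
  set c := g a - f a with hc
  have hc0 : 0 < ‖c‖ := norm_pos_iff.2 (sub_ne_zero.2 hne)
  have hcη : ‖c‖ ≤ η := hsup a ha
  obtain ⟨K, hKA, hKc, hxK, hKd, hKg⟩ := hcyl (f a) (hfA ha) (2 * ‖c‖) (by positivity)
  obtain ⟨y, hyK, hymax⟩ := hKc.exists_isMaxOn ⟨_, hxK⟩
    (f := fun z => ((starRingEnd ℂ) c * z).re) (by fun_prop)
  have hyd := hKd y hyK (f a) hxK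
  obtain ⟨b, hb, hby⟩ := hint y (hKA hyK) (by
    calc ‖y - x0‖ ≤ ‖y - f a‖ + ‖f a - x0‖ := norm_sub_le_norm_sub_add_norm_sub _ _ _
      _ < C * (2 * ‖c‖) + ρ / 2 := by linarith
      _ ≤ C * (2 * η) + ρ / 2 := by gcongr
      _ ≤ ρ := by linarith)
  have hba : κ * ‖b - a‖ ≤ C * (2 * ‖c‖) := by
    have := hlow b hb a ha
    rw [hby] at this
    exact this.trans hyd
  set e := (g b - y) - c with he
  have hee : ‖e‖ ≤ ‖c‖ / 2 := by
    have h3 := hlip b hb a ha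
    rw [hby] at h3
    have : κ * ‖e‖ ≤ κ * (‖c‖ / 2) := by
      calc κ * ‖e‖ ≤ κ * (η * ‖b - a‖) := by gcongr
        _ = η * (κ * ‖b - a‖) := by ring
        _ ≤ η * (C * (2 * ‖c‖)) := by gcongr
        _ = (4 * C * η) * (‖c‖ / 2) := by ring
        _ ≤ _ := by gcongr
    exact le_of_mul_le_mul_left this hκ
  have hgb : g b = y + c + e := by rw [he]; ring
  have hgK : g b ∈ K := by
    apply hKg y hyK _ (hgA hb)
    rw [hgb, show y - (y + c + e) = -(c + e) by ring, norm_neg]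
    exact (norm_add_le _ _).trans (by linarith)
  have hm : ((starRingEnd ℂ) c * g b).re ≤ ((starRingEnd ℂ) c * y).re := hymax hgK
  have e1 : ((starRingEnd ℂ) c * c).re = ‖c‖ ^ 2 := by
    rw [mul_comm, Complex.mul_conj, Complex.ofReal_re, Complex.normSq_eq_norm_sq]
  have e2 : |((starRingEnd ℂ) c * e).re| ≤ ‖c‖ * (‖c‖ / 2) := by
    refine (Complex.abs_re_le_norm _).trans ?_
    rw [norm_mul, Complex.norm_conj]
    gcongr
  rw [hgb, mul_add, mul_add, Complex.add_re, Complex.add_re, e1] at hm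
  have := (abs_le.1 e2).1
  nlinarith

lemma aux_lip {V N : Set ℂ} {δ M : ℝ} (hδ : 0 < δ) (hN : cthickening δ N ⊆ V) {f : ℂ → ℂ}
    (hf : DifferentiableOn ℂ f V) (hM : ∀ z ∈ cthickening δ N, ‖f z‖ ≤ M) :
    ∀ a ∈ N, ∀ b ∈ N, ‖f a - f b‖ ≤ 2 * M / δ * ‖a - b‖ := by
  intro a ha b hb
  have hb2 : ∀ y ∈ cthickening δ N, ‖f y - f a‖ ≤ 2 * M := fun y hy =>
    (norm_sub_le _ _).trans (by linarith [hM y hy, hM a (self_subset_cthickening _ ha)])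
  have hball : ball a δ ⊆ cthickening δ N :=
    ball_subset_closedBall.trans (closedBall_subset_cthickening ha δ)
  have hM0 : 0 ≤ M := (norm_nonneg _).trans (hM a (self_subset_cthickening _ ha))
  by_cases h : ‖a - b‖ < δ
  · have := Complex.dist_le_div_mul_dist_of_mapsTo_ball (f := f) (c := a) (z := b) (R₁ := δ)
      (R₂ := 2 * M) (hf.mono (hball.trans hN))
      (fun y hy => by rw [mem_closedBall, dist_eq_norm]; exact hb2 y (hball hy))
      (by rwa [mem_ball, dist_comm, dist_eq_norm])
    rwa [dist_comm, dist_eq_norm, dist_comm, dist_eq_norm] at this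
  · push Not at h
    rw [norm_sub_rev]
    refine (hb2 b (self_subset_cthickening _ hb)).trans ?_
    rw [div_mul_eq_mul_div, le_div_iff₀ hδ]
    gcongr

lemma aux_AA {N : Set ℂ} (hN : IsCompact N) {m : ℕ} {M L : ℝ} (hL : 0 ≤ L)
    (g : ℕ → Fin m → ℂ → ℂ) (hb : ∀ n i, ∀ z ∈ N, ‖g n i z‖ ≤ M)
    (hl : ∀ n i, ∀ a ∈ N, ∀ b ∈ N, ‖g n i a - g n i b‖ ≤ L * ‖a - b‖) :
    ∃ (φ : ℕ → ℕ) (f : Fin m → ℂ → ℂ), StrictMono φ ∧ ∀ η > 0, ∃ n0, ∀ n ≥ n0, ∀ i, ∀ z ∈ N,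
      ‖g (φ n) i z - f i z‖ ≤ η := by
  classical
  have : CompactSpace N := isCompact_iff_compactSpace.1 hN
  have hLip : ∀ n, LipschitzWith ⟨L, hL⟩ (fun (z : N) (i : Fin m) => g n i z) := by
    intro n
    apply LipschitzWith.of_dist_le_mul
    intro x y
    rw [dist_pi_le_iff (by positivity)]
    intro i
    rw [dist_eq_norm, Subtype.dist_eq, dist_eq_norm]
    exact hl n i x x.2 y y.2
  let Φ : ℕ → BoundedContinuousFunction N (Fin m → ℂ) := fun n =>
    BoundedContinuousFunction.mkOfCompact ⟨_, (hLip n).continuous⟩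
  have hcomp := BoundedContinuousFunction.arzela_ascoli (closedBall (0 : Fin m → ℂ) |M|)
    (isCompact_closedBall _ _) (range Φ)
    (by
      rintro _ x ⟨n, rfl⟩
      rw [mem_closedBall, dist_pi_le_iff (abs_nonneg M)]
      intro i
      rw [dist_eq_norm]
      simpa [Φ] using (hb n i x x.2).trans (le_abs_self M))
    (by
      apply UniformEquicontinuous.equicontinuous
      apply LipschitzWith.uniformEquicontinuous _ ⟨L, hL⟩
      rintro ⟨_, n, rfl⟩
      exact hLip n)
  obtain ⟨F, -, φ, hφ, hlim⟩ := hcomp.tendsto_subseq (x := Φ)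
    (fun n => subset_closure (mem_range_self n))
  refine ⟨φ, fun i z => if h : z ∈ N then F ⟨z, h⟩ i else 0, hφ, fun η hη => ?_⟩
  obtain ⟨n0, hn0⟩ := Metric.tendsto_atTop.1 hlim η hη
  refine ⟨n0, fun n hn i z hz => ?_⟩
  have h1 := hn0 n hn
  have h2 := (BoundedContinuousFunction.dist_coe_le_dist (f := Φ (φ n)) (g := F) ⟨z, hz⟩).trans h1.le
  have h3 := (dist_le_pi_dist _ _ i).trans h2
  rw [dist_eq_norm] at h3
  simpa [hz, Φ] using h3

lemma aux_baire {A : Set ℂ} {ι : Type*} (F : ι → Set ℂ) (hF : ∀ i, IsClosed (F i)) (s : Finset ι)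
    (hs : ∀ i ∈ s, ∀ x ∈ A, ∀ ρ > 0, ∃ z ∈ A, ‖z - x‖ < ρ ∧ z ∉ F i) :
    ∀ x ∈ A, ∀ ρ > 0, ∃ z ∈ A, ‖z - x‖ < ρ ∧ ∀ i ∈ s, z ∉ F i := by
  classical
  induction s using Finset.induction_on with
  | empty => intro x hx ρ hρ; exact ⟨x, hx, by simpa using hρ, by simp⟩
  | insert i s his ih =>
    intro x hx ρ hρ
    obtain ⟨z, hz, hzx, hzs⟩ := ih (fun j hj => hs j (Finset.mem_insert_of_mem hj)) x hx ρ hρ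
    have hop : IsOpen (⋂ j ∈ s, (F j)ᶜ) :=
      isOpen_biInter_finset fun j _ => (hF j).isOpen_compl
    obtain ⟨ρ', hρ', hb⟩ := Metric.isOpen_iff.1 hop z (by simpa using hzs)
    obtain ⟨y, hy, hyz, hyi⟩ := hs i (Finset.mem_insert_self _ _) z hz (min ρ' (ρ - ‖z - x‖))
      (lt_min hρ' (by linarith))
    refine ⟨y, hy, ?_, ?_⟩
    · have := lt_of_lt_of_le hyz (min_le_right _ _)
      linarith [norm_sub_le_norm_sub_add_norm_sub y z x]
    · intro j hj
      rcases Finset.mem_insert.1 hj with rfl | hj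
      · exact hyi
      · have := hb (show y ∈ ball z ρ' by
          rw [mem_ball, dist_eq_norm]; exact lt_of_lt_of_le hyz (min_le_left _ _))
        simp only [mem_iInter] at this
        exact this j hj

lemma aux_lim {A V : Set ℂ} (hAc : IsCompact A) (hAne : A.Nonempty)
    (hAiso : ∀ x ∈ A, x ∈ closure (A \ {x})) (hV : IsOpen V) (hc : IsPreconnected V)
    (hAV : A ⊆ V) {m : ℕ} (g : ℕ → Fin m → ℂ → ℂ)
    (hdiff : ∀ n i, DifferentiableOn ℂ (g n i) V) (hinj : ∀ n i, InjOn (g n i) V)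
    (hA : ∀ n, A = ⋃ i, g n i '' A) :
    ∃ (φ : ℕ → ℕ) (f : Fin m → ℂ → ℂ) (C : ℝ), StrictMono φ ∧ 0 < C ∧
      (∀ i, MapsTo (f i) A A) ∧ (∀ i, ContinuousOn (f i) A) ∧
      (∀ i, ∀ a ∈ A, ∀ b ∈ A, ∀ c ∈ A, ∀ d ∈ A,
        ‖f i a - f i b‖ * ‖c - d‖ ≤ C * ‖f i c - f i d‖) ∧
      (∀ η > 0, ∃ n0, ∀ n ≥ n0, ∀ i, (∀ a ∈ A, ‖g (φ n) i a - f i a‖ ≤ η) ∧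
        ∀ a ∈ A, ∀ b ∈ A, ‖(g (φ n) i a - f i a) - (g (φ n) i b - f i b)‖ ≤ η * ‖a - b‖) ∧
      A ⊆ ⋃ i, f i '' A := by
  have hgA : ∀ n i, MapsTo (g n i) A A := fun n i x hx => by
    rw [hA n]; exact mem_iUnion.2 ⟨i, x, hx, rfl⟩
  obtain ⟨δ0, hδ0, hδV⟩ := hAc.exists_cthickening_subset_open hV hAV
  set δ := δ0 / 2 with hδdef
  have hδ : 0 < δ := by positivity
  have hN2c : IsCompact (cthickening δ0 A) := hAc.cthickening
  have hN1c : IsCompact (cthickening δ A) := hAc.cthickening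
  have hN12 : cthickening δ (cthickening δ A) ⊆ cthickening δ0 A := by
    refine (cthickening_cthickening_subset hδ.le hδ.le A).trans ?_
    rw [hδdef, add_halves]
  have hAN1 : A ⊆ cthickening δ A := self_subset_cthickening A
  have hAN2 : A ⊆ cthickening δ0 A := self_subset_cthickening A
  have hN1V : cthickening δ A ⊆ V := (cthickening_mono (by linarith) A).trans hδV
  obtain ⟨C, hC, hdist⟩ := aux_distortion hV hc hN2c hδV
  obtain ⟨a0, ha0⟩ := hAne
  obtain ⟨a1, ha1, hne⟩ : ∃ a1 ∈ A, a1 ≠ a0 := by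
    obtain ⟨y, hy⟩ := closure_nonempty_iff.1 ⟨_, hAiso a0 ha0⟩
    exact ⟨y, hy.1, hy.2⟩
  have hpos : 0 < ‖a0 - a1‖ := norm_pos_iff.2 (sub_ne_zero.2 hne.symm)
  obtain ⟨B, hB⟩ := hAc.isBounded.exists_norm_le
  set M := B + C * (2 * B) / ‖a0 - a1‖ with hM
  have hB0 : 0 ≤ B := (norm_nonneg _).trans (hB a0 ha0)
  have hbd : ∀ n i, ∀ z ∈ cthickening δ0 A, ‖g n i z‖ ≤ M := by
    intro n i z hz
    have h := (hdist (g n i) (hdiff n i) (hinj n i) z hz a0 (hAN2 ha0) a0 (hAN2 ha0)).2 a1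
      (hAN2 ha1)
    have h' : ‖g n i a0 - g n i a1‖ ≤ 2 * B :=
      (norm_sub_le _ _).trans (by linarith [hB _ (hgA n i ha0), hB _ (hgA n i ha1)])
    have h'' : ‖g n i z - g n i a0‖ ≤ C * (2 * B) / ‖a0 - a1‖ := by
      rw [le_div_iff₀ hpos]
      exact h.trans (by gcongr)
    calc ‖g n i z‖ = ‖g n i a0 + (g n i z - g n i a0)‖ := by congr 1; ring
      _ ≤ ‖g n i a0‖ + ‖g n i z - g n i a0‖ := norm_add_le _ _
      _ ≤ _ := by linarith [hB _ (hgA n i ha0)]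
  have hM0 : 0 ≤ M := (norm_nonneg _).trans (hB a0 ha0) |>.trans (by
    rw [hM]; have : 0 ≤ C * (2 * B) / ‖a0 - a1‖ := by positivity
    linarith)
  obtain ⟨φ, f, hφ, hconv⟩ := aux_AA hN1c (M := M) (L := 2 * M / δ) (by positivity) g
    (fun n i z hz => hbd n i z (cthickening_mono (by linarith) A hz))
    (fun n i => aux_lip hδ (hN12.trans hδV) (hdiff n i) (fun z hz => hbd n i z (hN12 hz)))
  have htend : ∀ i, ∀ z ∈ cthickening δ A,
      Filter.Tendsto (fun n => g (φ n) i z) Filter.atTop (nhds (f i z)) := by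
    intro i z hz
    rw [Metric.tendsto_atTop]
    intro ε hε
    obtain ⟨n0, h0⟩ := hconv (ε / 2) (by positivity)
    refine ⟨n0, fun n hn => ?_⟩
    rw [dist_eq_norm]
    linarith [h0 n hn i z hz]
  have hfA : ∀ i, MapsTo (f i) A A := fun i a ha =>
    hAc.isClosed.mem_of_tendsto (htend i a (hAN1 ha)) (Filter.Eventually.of_forall
      fun n => hgA _ i ha)
  have hfd : ∀ i, ∀ a ∈ A, ∀ b ∈ A, ∀ c ∈ A, ∀ d ∈ A,
        ‖f i a - f i b‖ * ‖c - d‖ ≤ C * ‖f i c - f i d‖ := by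
    intro i a ha b hb c hc' d hd
    have t := fun z (hz : z ∈ A) => htend i z (hAN1 hz)
    refine le_of_tendsto_of_tendsto' ((((t a ha).sub (t b hb)).norm).mul_const _)
      ((((t c hc').sub (t d hd)).norm).const_mul _) fun n => ?_
    exact (hdist _ (hdiff _ i) (hinj _ i) a (hAN2 ha) b (hAN2 hb) c (hAN2 hc')).2 d (hAN2 hd)
  have hfl : ∀ i, ContinuousOn (f i) A := by
    intro i
    have : LipschitzOnWith (2 * M / δ).toNNReal (f i) A := by
      refine LipschitzOnWith.of_dist_le_mul fun a ha b hb => ?_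
      rw [dist_eq_norm, dist_eq_norm, Real.coe_toNNReal _ (by positivity)]
      refine le_of_tendsto' ((htend i a (hAN1 ha)).sub (htend i b (hAN1 hb))).norm fun n => ?_
      exact aux_lip hδ (hN12.trans hδV) (hdiff _ i) (fun z hz => hbd _ i z (hN12 hz)) a
        (hAN1 ha) b (hAN1 hb)
    exact this.continuousOn
  refine ⟨φ, f, C, hφ, hC, hfA, hfl, hfd, ?_, ?_⟩
  · intro η hη
    obtain ⟨n0, h0⟩ := hconv (min η (η * δ / 4)) (by positivity)
    refine ⟨n0, fun n hn i => ⟨fun a ha => (h0 n hn i a (hAN1 ha)).trans (min_le_left _ _), ?_⟩⟩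
    intro a ha b hb
    have ht : Filter.Tendsto (fun k => ‖(g (φ n) i a - g (φ k) i a) -
        (g (φ n) i b - g (φ k) i b)‖) Filter.atTop
        (nhds ‖(g (φ n) i a - f i a) - (g (φ n) i b - f i b)‖) :=
      ((tendsto_const_nhds.sub (htend i a (hAN1 ha))).sub
        (tendsto_const_nhds.sub (htend i b (hAN1 hb)))).norm
    refine le_of_tendsto ht ?_
    filter_upwards [Filter.eventually_ge_atTop n0] with k hk
    have := aux_lip (f := fun z => g (φ n) i z - g (φ k) i z) (M := η * δ / 2) (N := A) hδ hN1V
      ((hdiff _ i).sub (hdiff _ i)) (fun z hz => by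
        have e1 := (h0 n hn i z hz).trans (min_le_right _ _)
        have e2 := (h0 k hk i z hz).trans (min_le_right _ _)
        calc ‖g (φ n) i z - g (φ k) i z‖ =
            ‖(g (φ n) i z - f i z) - (g (φ k) i z - f i z)‖ := by congr 1; ring
          _ ≤ _ := norm_sub_le _ _
          _ ≤ _ := by linarith) a ha b hb
    refine this.trans (le_of_eq ?_)
    field_simp
  · intro x hx
    have hcl : IsClosed (⋃ i, f i '' A) :=
      isClosed_iUnion_of_finite fun i => (hAc.image_of_continuousOn (hfl i)).isClosed
    rw [← hcl.closure_eq, Metric.mem_closure_iff]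
    intro ε hε
    obtain ⟨n0, h0⟩ := hconv (ε / 2) (by positivity)
    have hx' := hx
    rw [hA (φ n0)] at hx'
    obtain ⟨i, a, ha, rfl⟩ := mem_iUnion.1 hx'
    refine ⟨f i a, mem_iUnion.2 ⟨i, a, ha, rfl⟩, ?_⟩
    rw [dist_eq_norm]
    linarith [h0 n0 le_rfl i a (hAN1 ha)]

lemma aux_core {A V : Set ℂ} (hAc : IsCompact A) (hAne : A.Nonempty)
    (hAiso : ∀ x ∈ A, x ∈ closure (A \ {x})) (hV : IsOpen V) (hc : IsPreconnected V)
    (hAV : A ⊆ V) {D : ℝ} (hD : 0 < D)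
    (hcyl : ∀ x ∈ A, ∀ ε > 0, ∃ K ⊆ A, IsCompact K ∧ x ∈ K ∧
      (∀ p ∈ K, ∀ q ∈ K, ‖p - q‖ ≤ D * ε) ∧ ∀ y ∈ K, ∀ z ∈ A, ‖y - z‖ ≤ ε → z ∈ K)
    {m : ℕ} (g : ℕ → Fin m → ℂ → ℂ)
    (hdiff : ∀ n i, DifferentiableOn ℂ (g n i) V) (hinj : ∀ n i, InjOn (g n i) V)
    (hA : ∀ n, A = ⋃ i, g n i '' A)
    (hs : ∀ n i j, i ≠ j → Disjoint (g n i '' A) (g n j '' A)) (i0 : Fin m) :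
    ∃ n k, n ≠ k ∧ EqOn (g n i0) (g k i0) V := by
  obtain ⟨φ, f, C, hφ, hC, hfA, hfc, hfd, hconv, hcov⟩ :=
    aux_lim hAc hAne hAiso hV hc hAV g hdiff hinj hA
  have hgA : ∀ n i, MapsTo (g n i) A A := fun n i x hx => by
    rw [hA n]; exact mem_iUnion.2 ⟨i, x, hx, rfl⟩
  have hnear : ∀ x ∈ A, ∀ ρ > 0, ∃ z ∈ A, z ≠ x ∧ ‖z - x‖ < ρ := by
    intro x hx ρ hρ
    obtain ⟨z, hz, hd⟩ := Metric.mem_closure_iff.1 (hAiso x hx) ρ hρ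
    refine ⟨z, hz.1, hz.2, ?_⟩
    rwa [← dist_eq_norm, dist_comm]
  let I : Fin m → Prop := fun i => ∃ x0 ∈ A, ∃ ρ > 0, ∀ z ∈ A, ‖z - x0‖ < ρ → z ∈ f i '' A
  have step3 : ∀ i, I i → ∃ n0, ∀ n ≥ n0, ∀ k ≥ n0, EqOn (g (φ n) i) (g (φ k) i) V := by
    rintro i ⟨x0, hx0, ρ, hρ, hint⟩
    obtain ⟨a, ha, hax⟩ := hint x0 hx0 (by simpa using hρ)
    obtain ⟨z, hz, hzx, hzρ⟩ := hnear x0 hx0 ρ hρ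
    obtain ⟨b, hb, rfl⟩ := hint z hz hzρ
    have hspos : 0 < ‖f i a - f i b‖ := norm_pos_iff.2 (sub_ne_zero.2 (by
      rw [hax]; exact hzx.symm))
    set κ := ‖f i a - f i b‖ / C with hκ
    have hκ0 : 0 < κ := by positivity
    set η := min κ ρ / (4 * D) with hη
    have hη0 : 0 < η := by
      have : 0 < min κ ρ := lt_min hκ0 hρ
      positivity
    have h4 : 4 * D * η = min κ ρ := by rw [hη]; field_simp
    obtain ⟨n0, h0⟩ := hconv η hη0
    have hlow : ∀ c ∈ A, ∀ d ∈ A, κ * ‖c - d‖ ≤ ‖f i c - f i d‖ := by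
      intro c hc' d hd
      have := hfd i a ha b hb c hc' d hd
      rw [hκ, div_mul_eq_mul_div, div_le_iff₀ hC]
      linarith
    have heq : ∀ n ≥ n0, ∀ c ∈ A, ‖f i c - x0‖ < ρ / 2 → g (φ n) i c = f i c := by
      intro n hn
      exact aux_rigid hD hcyl hκ0 hη0 (hfA i) (hgA _ i) hlow (h0 n hn i).2 (h0 n hn i).1 hint
        (h4 ▸ min_le_left _ _) (h4 ▸ min_le_right _ _)
    refine ⟨n0, fun n hn k hk => ?_⟩
    refine AnalyticOnNhd.eqOn_of_preconnected_of_frequently_eq ((hdiff _ i).analyticOnNhd hV)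
      ((hdiff _ i).analyticOnNhd hV) hc (hAV ha) ?_
    obtain ⟨ε, hε, hcont⟩ := Metric.continuousOn_iff.1 (hfc i) a ha (ρ / 2) (by positivity)
    rw [Filter.frequently_iff]
    intro U hU
    obtain ⟨ε', hε', hU'⟩ := Metric.mem_nhdsWithin_iff.1 hU
    obtain ⟨z, hz, hza, hzd⟩ := hnear a ha (min ε ε') (lt_min hε hε')
    refine ⟨z, hU' ⟨?_, hza⟩, ?_⟩
    · rw [mem_ball, dist_eq_norm]; exact hzd.trans_le (min_le_right _ _)
    · have := hcont z hz (by rw [dist_eq_norm]; exact hzd.trans_le (min_le_left _ _))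
      rw [dist_eq_norm, hax] at this
      rw [heq n hn z hz this, heq k hk z hz this]
  have htend : ∀ i, ∀ z ∈ A,
      Filter.Tendsto (fun n => g (φ n) i z) Filter.atTop (nhds (f i z)) := by
    intro i z hz
    rw [Metric.tendsto_atTop]
    intro ε hε
    obtain ⟨n0, h0⟩ := hconv (ε / 2) (by positivity)
    refine ⟨n0, fun n hn => ?_⟩
    rw [dist_eq_norm]
    linarith [(h0 n hn i).1 z hz]
  have step3' : ∀ i, ∃ n0, ∀ n ≥ n0, I i → ∀ a ∈ A, g (φ n) i a = f i a := by
    intro i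
    by_cases hI : I i
    · obtain ⟨n0, h0⟩ := step3 i hI
      refine ⟨n0, fun n hn _ a ha => ?_⟩
      refine tendsto_nhds_unique ?_ (htend i a ha)
      refine tendsto_const_nhds.congr' ?_
      filter_upwards [Filter.eventually_ge_atTop n0] with k hk
      exact h0 n hn k hk (hAV ha)
    · exact ⟨0, fun n _ h => absurd h hI⟩
  have hI0 : I i0 := by
    by_contra hI
    classical
    have hfcl : ∀ i, IsClosed (f i '' A) := fun i =>
      (hAc.image_of_continuousOn (hfc i)).isClosed
    have hb := aux_baire (A := A) (fun i => f i '' A) hfcl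
      (Finset.univ.filter fun i => ¬ I i) (by
        intro i hi x hx ρ hρ
        by_contra hcon
        push Not at hcon
        exact (Finset.mem_filter.1 hi).2 ⟨x, hx, ρ, hρ, hcon⟩)
    have hcl : IsClosed (⋃ i : {i // I i}, f i '' A) :=
      isClosed_iUnion_of_finite fun i => hfcl i
    have hcov' : A ⊆ ⋃ i : {i // I i}, f i '' A := by
      intro x hx
      rw [← hcl.closure_eq, Metric.mem_closure_iff]
      intro ε hε
      obtain ⟨z, hz, hzx, hzn⟩ := hb x hx ε hε
      obtain ⟨i, hi⟩ := mem_iUnion.1 (hcov hz)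
      refine ⟨z, mem_iUnion.2 ⟨⟨i, ?_⟩, hi⟩, ?_⟩
      · by_contra hn
        exact hzn i (by simp [hn]) hi
      · rwa [dist_comm, dist_eq_norm]
    choose n0 hn0 using step3'
    set n := Finset.univ.sup n0 with hn
    obtain ⟨a, ha⟩ := hAne
    obtain ⟨⟨i, hi⟩, b, hb', hbe⟩ := mem_iUnion.1 (hcov' (hgA (φ n) i0 ha))
    have e := hn0 i n (Finset.le_sup (Finset.mem_univ i)) hi b hb'
    refine Set.disjoint_left.1 (hs (φ n) i i0 (fun h => hI (h ▸ hi))) ⟨b, hb', rfl⟩ ⟨a, ha, ?_⟩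
    rw [e]; exact hbe.symm
  obtain ⟨n0, h0⟩ := step3 i0 hI0
  exact ⟨φ n0, φ (n0 + 1), (hφ (Nat.lt_succ_self n0)).ne, h0 n0 le_rfl _ (Nat.le_succ n0)⟩

/-- Corollary: let `A ⊂ ℂ` be a Cantor set, `V` a connected open neighborhood of `A`, and
`𝒢` a collection of holomorphic IFS with attractor `A` and `V ⊆ Ω_G`, such that either
(a) there is `r > 0` with `dist (g '' A) (g̃ '' A) ≥ r` for any two different maps of any
`G ∈ 𝒢`, or (b) `A ⊂ ℝ`, all `G ∈ 𝒢` are real with the SSC, and `sup {#G} < ∞`.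
Then the set of restrictions `{g|_V : g ∈ G, G ∈ 𝒢}` is finite. -/
theorem stmt_10 (A V : Set ℂ)
    (hAc : IsCompact A) (hAne : A.Nonempty) (hAtd : IsTotallyDisconnected A)
    (hAiso : ∀ x ∈ A, x ∈ closure (A \ {x}))
    (hVopen : IsOpen V) (hVconn : IsConnected V) (hAV : A ⊆ V)
    (𝒢 : Set HolIFS)
    (h1 : ∀ G ∈ 𝒢, G.IsAttractor A ∧ V ⊆ G.Ω)
    (h2 : (∃ r > (0 : ℝ), ∀ G ∈ 𝒢, ∀ i j : Fin G.m, i ≠ j →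
            ∀ x ∈ G.g i '' A, ∀ y ∈ G.g j '' A, r ≤ dist x y) ∨
          ((∀ z ∈ A, z.im = 0) ∧ (∀ G ∈ 𝒢, G.IsReal ∧ G.SSC A) ∧
            ∃ M : ℕ, ∀ G ∈ 𝒢, G.m ≤ M)) :
    Set.Finite {h : V → ℂ | ∃ G ∈ 𝒢, ∃ i : Fin G.m, h = V.restrict (G.g i)} := by
  have h3 : (∀ G ∈ 𝒢, G.SSC A) ∧ ∃ M : ℕ, ∀ G ∈ 𝒢, G.m ≤ M := by
    rcases h2 with ⟨r, hr, h⟩ | ⟨-, h, h'⟩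
    · refine ⟨fun G hG i j hij => Set.disjoint_left.2 fun x hx hx' => ?_, ?_⟩
      · have := h G hG i j hij x hx x hx'
        rw [dist_self] at this
        linarith
      · obtain ⟨t, -, htf, ht⟩ := hAc.finite_cover_balls (half_pos hr)
        refine ⟨t.ncard, fun G hG => ?_⟩
        obtain ⟨a, ha⟩ := hAne
        have hmem : ∀ i, G.g i a ∈ A := fun i => by
          have := (h1 G hG).1.2.2.2
          rw [this]; exact mem_iUnion.2 ⟨i, a, ha, rfl⟩
        have : ∀ i, ∃ x ∈ t, dist (G.g i a) x < r / 2 := fun i => by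
          simpa using ht (hmem i)
        choose c hct hcd using this
        have hci : Function.Injective c := by
          intro i j hij
          by_contra hne
          have e := h G hG i j hne _ ⟨a, ha, rfl⟩ _ ⟨a, ha, rfl⟩
          have e1 := hcd i
          have e2 := hcd j
          rw [← hij] at e2
          have := dist_triangle_right (G.g i a) (G.g j a) (c i)
          linarith
        have hcard : (Set.range c).ncard = G.m := by
          rw [← Set.image_univ, Set.ncard_image_of_injective _ hci, Set.ncard_univ]; simp
        rw [← hcard]
        exact Set.ncard_le_ncard (by rintro _ ⟨i, rfl⟩; exact hct i) htf
    · exact ⟨fun G hG => (h G hG).2, h'⟩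
  obtain ⟨hssc, M, hM⟩ := h3
  by_contra hinf
  let e := Set.Infinite.natEmbedding _ hinf
  have he : ∀ n, ∃ G ∈ 𝒢, ∃ i : Fin G.m, (e n).1 = V.restrict (G.g i) := fun n => (e n).2
  choose G hG i hi using he
  let q : ℕ → Fin (M + 1) × Fin (M + 1) := fun n =>
    (⟨(G n).m, Nat.lt_succ_of_le (hM _ (hG n))⟩,
     ⟨(i n).1, ((i n).2.le.trans (hM _ (hG n))).trans_lt (Nat.lt_succ_self M)⟩)
  obtain ⟨y, hy⟩ := Finite.exists_infinite_fiber q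
  let s : ℕ ↪ (q ⁻¹' {y}) := Infinite.natEmbedding _
  have hsq : ∀ n, q (s n).1 = y := fun n => (s n).2
  have hsm : ∀ n, (G (s n).1).m = y.1.1 := fun n =>
    congrArg (fun p : Fin (M + 1) × Fin (M + 1) => p.1.1) (hsq n)
  have hsi : ∀ n, (i (s n).1).1 = y.2.1 := fun n =>
    congrArg (fun p : Fin (M + 1) × Fin (M + 1) => p.2.1) (hsq n)
  obtain ⟨D, hD, hcyl⟩ := (G 0).cylinders (h1 _ (hG 0)).1 (hssc _ (hG 0)) hAiso
  have hlt : y.2.1 < y.1.1 := by rw [← hsm 0, ← hsi 0]; exact (i (s 0).1).2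
  obtain ⟨n, k, hnk, heq⟩ := aux_core hAc hAne hAiso hVopen hVconn.isPreconnected hAV hD hcyl
    (m := y.1.1) (fun n j => (G (s n).1).g (Fin.cast (hsm n).symm j))
    (fun n j => ((G (s n).1).hdiff _).mono (h1 _ (hG _)).2)
    (fun n j => ((G (s n).1).hinj _).mono (h1 _ (hG _)).2)
    (fun n => by
      have := (h1 _ (hG (s n).1)).1.2.2.2
      refine this.trans ?_
      exact ((finCongr (hsm n).symm).surjective.iUnion_comp fun j => (G (s n).1).g j '' A).symm)
    (fun n j j' hj => hssc _ (hG _) _ _ (fun h => hj (Fin.cast_injective _ h))) ⟨y.2.1, hlt⟩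
  have hcast : ∀ n, Fin.cast (hsm n).symm ⟨y.2.1, hlt⟩ = i (s n).1 := fun n => by
    ext; simp [hsi n]
  refine hnk (s.injective (Subtype.ext (e.injective (Subtype.ext ?_))))
  rw [hi, hi]
  funext z
  have := heq z.2
  simp only [hcast] at this
  exact this
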